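/- Let (G,R) be a cyclically ordered abelian group such that G is divisible and (G,R) is discrete. Then G is torsion-free: no nonzero element of G has finite order. -/

import Mathlib

/-- A cyclic order on an (additive) abelian group: a ternary relation that is strict, cyclic,
such that the induced binary relation at each point is transitive and total on distinct triples,
and which is compatible with translation. -/
def IsCyclicOrder {G : Type*} [AddCommGroup G] (R : G → G → G → Prop) : Prop :=
  (∀ a b c : G, R a b c → a ≠ b ∧ b ≠ c ∧ c ≠ a) ∧
  (∀ a b c : G, R a b c → R b c a) ∧
  (∀ a b c d : G, R a b c → R a c d → R a b d) ∧
  (∀ a b c : G, a ≠ b → b ≠ c → c ≠ a → R a b c ∨ R a c b) ∧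
  (∀ a b c x : G, R a b c → R (a + x) (b + x) (c + x))

namespace IsCyclicOrder

variable {G : Type*} [AddCommGroup G] {R : G → G → G → Prop}

theorem rotate (hR : IsCyclicOrder R) {a b c : G} (h : R a b c) : R b c a :=
  hR.2.1 a b c h

theorem trans (hR : IsCyclicOrder R) {a b c d : G} (h : R a b c) (h' : R a c d) : R a b d :=
  hR.2.2.1 a b c d h h'

theorem translate (hR : IsCyclicOrder R) {a b c a' b' c' : G} (x : G) (h : R a b c)
    (ha : a + x = a') (hb : b + x = b') (hc : c + x = c') : R a' b' c' := by
  subst ha hb hc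
  exact hR.2.2.2.2 a b c x h

theorem not_right_eq (hR : IsCyclicOrder R) (a b : G) : ¬ R a b b :=
  fun h => (hR.1 a b b h).2.1 rfl

/-- Every nonempty finite set has a first element for the strict order obtained by cutting the
circle at a point. -/
theorem exists_first_of_finite (hR : IsCyclicOrder R) (a : G) {s : Set G} (hs : s.Finite)
    (hne : s.Nonempty) : ∃ m ∈ s, ∀ x ∈ s, ¬ R a x m := by
  have : IsStrictOrder G (R a) :=
    { irrefl := hR.not_right_eq a, trans := fun _ _ _ h h' => hR.trans h h' }
  obtain ⟨x, hx⟩ := hne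
  obtain ⟨m, -, hm⟩ := (hs.wellFoundedOn (r := R a)).has_min Set.univ ⟨⟨x, hx⟩, trivial⟩
  exact ⟨m, m.2, fun y hy => hm ⟨y, hy⟩ trivial⟩

/-- Negation reverses a cyclic order. -/
theorem neg (hR : IsCyclicOrder R) {a b : G} (h : R 0 a b) : R 0 (-b) (-a) := by
  obtain ⟨ha, hab, hb⟩ := hR.1 _ _ _ h
  refine (hR.2.2.2.1 0 (-b) (-a) (by simpa using hb) (by simpa using hab.symm)
    (by simpa using ha.symm)).resolve_right fun hc => ?_
  have h1 : R 0 (b - a) (-a) :=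
    hR.rotate (hR.translate (a' := -a) (b' := 0) (-a) h (by abel) (by abel) (by abel))
  have h2 : R 0 b (b - a) :=
    hR.rotate (hR.rotate (hR.translate (c' := 0) b hc (by abel) (by abel) (by abel)))
  have h3 : R a (a + a) 0 :=
    hR.translate a (hR.trans h (hR.trans h2 h1)) (by abel) (by abel) (by abel)
  have h4 : R 0 (-b) (a - b) :=
    hR.rotate (hR.rotate (hR.translate (c' := 0) (-b) h (by abel) (by abel) (by abel)))
  have h5 : R 0 (a - b) a :=
    hR.rotate (hR.translate (b' := 0) a hc (by abel) (by abel) (by abel))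
  have h6 : R a (a - b) (a + a) :=
    hR.translate a (hR.trans h4 h5) (by abel) (by abel) (by abel)
  have h7 : R 0 a (a - b) := hR.rotate (hR.rotate (hR.trans h6 h3))
  exact hR.not_right_eq _ _ (hR.trans h7 h5)

theorem sub_left (hR : IsCyclicOrder R) {a b : G} (h : R 0 a b) : R 0 (b - a) b :=
  hR.rotate (hR.translate b (hR.neg h) (by abel) (by abel) (by abel))

theorem add_right (hR : IsCyclicOrder R) {x y w : G} (h : R 0 x y) (hw : R 0 w (y + w)) :
    R 0 w (x + w) ∧ R 0 (x + w) (y + w) := by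
  have h1 : R w (x + w) (y + w) := hR.translate w h (by abel) rfl rfl
  have h2 : R w (x + w) 0 := hR.trans h1 (hR.rotate hw)
  refine ⟨hR.rotate (hR.rotate h2), hR.rotate ?_⟩
  exact hR.rotate (hR.rotate (hR.rotate (hR.trans (hR.rotate (hR.rotate hw))
    (hR.rotate (hR.rotate h1)))))

theorem add_add (hR : IsCyclicOrder R) {x y b w : G} (hxy : R 0 x y) (hbw : R 0 b w)
    (hy : R 0 y (y + w)) : R 0 (x + b) (y + w) := by
  have hw : R 0 w (y + w) := by simpa using hR.sub_left hy
  obtain ⟨h1, h2⟩ := hR.add_right hxy hw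
  have h3 : R 0 x (w + x) := by simpa [add_comm] using hR.sub_left h1
  have h4 := (hR.add_right hbw h3).2
  rw [add_comm b, add_comm w] at h4
  exact hR.trans h4 h2

/-- Successive multiples of the first nonzero element of a subgroup are in increasing order. -/
theorem nsmul_lt_succ_nsmul (hR : IsCyclicOrder R) {w : G} {T : AddSubgroup G} (hw : w ∈ T)
    (hmin : ∀ x ∈ T, x ≠ 0 → ¬ R 0 x w) {i : ℕ} (hi : i • w ≠ 0) (hi' : (i + 1) • w ≠ 0) :
    R 0 (i • w) (i • w + w) := by
  rw [succ_nsmul] at hi'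
  have hw0 : w ≠ 0 := by
    rintro rfl
    simp at hi
  refine (hR.2.2.2.1 _ _ _ hi.symm (by simpa using hw0) hi').resolve_right fun h => ?_
  refine hmin (-(i • w)) (T.neg_mem (T.nsmul_mem hw i)) (by simpa using hi) ?_
  exact hR.translate (-(i • w)) (hR.rotate (hR.rotate h)) (by abel) (by abel) (by abel)

end IsCyclicOrder

/-- A discrete divisible cyclically ordered abelian group is torsion-free. -/
theorem torsionFree_of_discrete_divisible
    {G : Type*} [AddCommGroup G] (R : G → G → G → Prop) (hR : IsCyclicOrder R)
    (hdiv : ∀ n : ℕ, 1 ≤ n → ∀ a : G, ∃ b : G, n • b = a)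
    (hdisc : ∃ g : G, g ≠ 0 ∧ ∀ h : G, ¬ R 0 h g) :
    ∀ g : G, g ≠ 0 → ¬ IsOfFinAddOrder g := by
  intro t ht hfin
  obtain ⟨g, hg0, hg⟩ := hdisc
  have hTfin : (AddSubgroup.zmultiples t : Set G).Finite := by
    simpa using hfin
  obtain ⟨w, ⟨hwT, hw0⟩, hwmin⟩ : ∃ w ∈ (AddSubgroup.zmultiples t : Set G) \ {0},
      ∀ x ∈ (AddSubgroup.zmultiples t : Set G) \ {0}, ¬ R 0 x w :=
    hR.exists_first_of_finite 0 (hTfin.subset Set.sdiff_subset)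
      ⟨t, AddSubgroup.mem_zmultiples t, ht⟩
  have hwfin : IsOfFinAddOrder w :=
    finite_zmultiples.mp (hTfin.subset (AddSubgroup.zmultiples_le_of_mem hwT))
  have hmin : ∀ x ∈ AddSubgroup.zmultiples t, x ≠ 0 → ¬ R 0 x w :=
    fun x hx hx0 => hwmin x ⟨hx, hx0⟩
  obtain ⟨n, hn⟩ : ∃ n, addOrderOf w = n + 1 :=
    Nat.exists_eq_succ_of_ne_zero hwfin.addOrderOf_pos.ne'
  have hnw : (n + 1) • w = 0 := hn ▸ addOrderOf_nsmul_eq_zero w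
  have hlt : ∀ i, 0 < i → i < n + 1 → i • w ≠ 0 := fun i hi hin =>
    nsmul_ne_zero_of_lt_addOrderOf hi.ne' (hn ▸ hin)
  have hn1 : 1 ≤ n := by
    by_contra! h
    obtain rfl : n = 0 := by omega
    exact hw0 (by simpa using hnw)
  obtain ⟨b₀, hb₀⟩ := hdiv (n + 1) (by omega) g
  -- the first solution of `(n + 1) • b = g` in the coset of `b₀` modulo the multiples of `w`
  obtain ⟨_, ⟨k, hk, rfl⟩, hbmin⟩ :=
    hR.exists_first_of_finite 0 ((finite_zmultiples.mpr hwfin).image (b₀ + ·))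
      ⟨_, 0, zero_mem _, rfl⟩
  set b := b₀ + k
  have hkn : (n + 1) • k = 0 := by
    obtain ⟨z, rfl⟩ := hk
    simp only [smul_comm (n + 1) z w, hnw, smul_zero]
  have hb : (n + 1) • b = g := by rw [smul_add, hb₀, hkn, add_zero]
  have hbw : R 0 b w := by
    refine (hR.2.2.2.1 0 b w ?_ ?_ hw0).resolve_right fun h => ?_
    · intro h
      rw [← h, smul_zero] at hb
      exact hg0 hb.symm
    · intro h
      rw [h, hnw] at hb
      exact hg0 hb.symm
    · exact hbmin (b - w) ⟨k - w, sub_mem hk (AddSubgroup.mem_zmultiples w),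
        (add_sub_assoc _ _ _).symm⟩ (hR.sub_left h)
  have key : ∀ i, 1 ≤ i → i ≤ n → R 0 (i • b) (i • w) := by
    intro i hi
    induction i, hi using Nat.le_induction with
    | base => simpa using fun _ => hbw
    | succ i hi ih =>
      intro hin
      rw [succ_nsmul, succ_nsmul]
      exact hR.add_add (ih (by omega)) hbw (hR.nsmul_lt_succ_nsmul hwT hmin
        (hlt i (by omega) (by omega)) (hlt (i + 1) (by omega) (by omega)))
  have h1 : R 0 (n • b) (-w) := by
    rw [← eq_neg_of_add_eq_zero_left ((succ_nsmul w n).symm.trans hnw)]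
    exact key n hn1 le_rfl
  have h2 : R b g 0 := by
    refine hR.translate b (hR.trans h1 (hR.neg hbw)) (zero_add b) ?_ (neg_add_cancel b)
    rw [← succ_nsmul, hb]
  exact hg b (hR.rotate (hR.rotate h2))
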